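/- For natural numbers n ≥ 1 and 1 ≤ k ≤ n, the Hessian of the Bézier derivative norm, namely the matrix L = D(n,k)ᵀ · H_N(n−k) · D(n,k) ∈ ℝ^{(n+1)×(n+1)}, is symmetric positive semidefinite and satisfies L·𝟙 = 0, where 𝟙 ∈ ℝ^{n+1} is the all-ones vector; that is, L is a (possibly negatively weighted) graph Laplacian matrix of the Bézier control points. -/

import Mathlib

open Matrix

/-- The `k`-th order forward finite-difference matrix `D(n,k) ∈ ℝ^{(n-k+1)×(n+1)}`. -/
noncomputable def Dmat (n k : ℕ) : Matrix (Fin (n - k + 1)) (Fin (n + 1)) ℝ :=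
  fun i j =>
    if (i : ℕ) ≤ (j : ℕ) ∧ (j : ℕ) ≤ (i : ℕ) + k then
      (k.choose ((j : ℕ) - (i : ℕ)) : ℝ) * (-1 : ℝ) ^ (k - ((j : ℕ) - (i : ℕ)))
    else 0

/-- The Bézier norm Hessian `H_N(m)` with entries
`[H_N(m)]_{i+1,j+1} = (1/(2m+1)) C(m,i) C(m,j) / C(2m, i+j)`. -/
noncomputable def bezierNormHessian (m : ℕ) : Matrix (Fin (m + 1)) (Fin (m + 1)) ℝ :=
  fun i j =>
    (1 / (2 * (m : ℝ) + 1)) * ((m.choose (i : ℕ) : ℝ) * (m.choose (j : ℕ) : ℝ)) /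
      ((2 * m).choose ((i : ℕ) + (j : ℕ)) : ℝ)

theorem integral_pow_mul_one_sub_pow (a b : ℕ) :
    ∫ t in (0 : ℝ)..1, t ^ a * (1 - t) ^ b = 1 / (((a + b : ℕ) + 1) * ((a + b).choose a : ℝ)) := by
  induction b generalizing a with
  | zero => simp [integral_pow]
  | succ b ih =>
    have hderiv (t : ℝ) : HasDerivAt (fun t : ℝ => t ^ (a + 1) * (1 - t) ^ (b + 1))
        (((a : ℝ) + 1) * (t ^ a * (1 - t) ^ (b + 1)) -
          ((b : ℝ) + 1) * (t ^ (a + 1) * (1 - t) ^ b)) t := by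
      refine ((hasDerivAt_pow (a + 1) t).mul
        (((hasDerivAt_id t).const_sub 1).pow (b + 1))).congr_deriv ?_
      simp
      ring
    have hparts := intervalIntegral.integral_eq_sub_of_hasDerivAt (a := 0) (b := 1)
      (fun t _ => hderiv t) (Continuous.intervalIntegrable (by fun_prop) _ _)
    rw [intervalIntegral.integral_sub (Continuous.intervalIntegrable (by fun_prop) _ _)
      (Continuous.intervalIntegrable (by fun_prop) _ _), intervalIntegral.integral_const_mul,
      intervalIntegral.integral_const_mul, ih (a + 1)] at hparts
    have hchoose : ((a + 1 + b).choose (a + 1) : ℝ) * (a + 1) =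
        ((a + 1 + b).choose a : ℝ) * (b + 1) := by
      have h := Nat.choose_succ_right_eq (a + 1 + b) a
      rw [show a + 1 + b - a = b + 1 by lia] at h
      exact_mod_cast h
    have hpos : (0 : ℝ) < ((a + 1 + b).choose (a + 1) : ℝ) :=
      Nat.cast_pos.2 (Nat.choose_pos (by lia))
    have hpos' : (0 : ℝ) < ((a + 1 + b).choose a : ℝ) :=
      Nat.cast_pos.2 (Nat.choose_pos (by lia))
    have ha : (0 : ℝ) < a + 1 := by positivity
    rw [show a + (b + 1) = a + 1 + b by lia]
    apply mul_left_cancel₀ ha.ne'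
    have hparts' : ((a : ℝ) + 1) * ∫ t in (0 : ℝ)..1, t ^ a * (1 - t) ^ (b + 1) =
        (b + 1) * (1 / (((a + 1 + b : ℕ) + 1) * ((a + 1 + b).choose (a + 1) : ℝ))) := by
      simpa [sub_eq_zero] using hparts
    rw [hparts']
    field_simp
    linarith

theorem bezierNormHessian_apply_eq_integral (m : ℕ) (i j : Fin (m + 1)) :
    bezierNormHessian m i j = ∫ t in (0 : ℝ)..1,
      (m.choose i * (t ^ (i : ℕ) * (1 - t) ^ (m - i))) *
        (m.choose j * (t ^ (j : ℕ) * (1 - t) ^ (m - j))) := by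
  have hexp : (i : ℕ) + j + (m - i + (m - j)) = 2 * m := by lia
  have hint := integral_pow_mul_one_sub_pow (i + j) (m - i + (m - j))
  rw [hexp] at hint
  calc
    _ = (m.choose i * m.choose j : ℝ) *
        ∫ t in (0 : ℝ)..1, t ^ ((i : ℕ) + j) * (1 - t) ^ (m - i + (m - j)) := by
      rw [hint, bezierNormHessian]
      push_cast
      simp only [mul_inv, div_eq_mul_inv]
      ring
    _ = _ := by
      rw [← intervalIntegral.integral_const_mul]
      congr 1 with t
      ring

theorem bezierNormHessian_posSemidef (m : ℕ) : (bezierNormHessian m).PosSemidef := by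
  refine .of_dotProduct_mulVec_nonneg ?_ fun x => ?_
  · ext i j
    simp [bezierNormHessian, add_comm, mul_comm]
  · have hsq : star x ⬝ᵥ (bezierNormHessian m *ᵥ x) = ∫ t in (0 : ℝ)..1,
        (∑ i : Fin (m + 1), x i * (m.choose i * (t ^ (i : ℕ) * (1 - t) ^ (m - i)))) ^ 2 := by
      simp only [dotProduct, mulVec, star_trivial, bezierNormHessian_apply_eq_integral, sq]
      simp_rw [Finset.sum_mul_sum, Finset.mul_sum]
      rw [intervalIntegral.integral_finsetSum
        fun i _ => Continuous.intervalIntegrable (by fun_prop) _ _]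
      refine Finset.sum_congr rfl fun i _ => ?_
      rw [intervalIntegral.integral_finsetSum
        fun j _ => Continuous.intervalIntegrable (by fun_prop) _ _]
      refine Finset.sum_congr rfl fun j _ => ?_
      rw [← intervalIntegral.integral_mul_const, ← intervalIntegral.integral_const_mul]
      congr 1 with t
      ring
    rw [hsq]
    exact intervalIntegral.integral_nonneg zero_le_one fun t _ => sq_nonneg _

theorem Dmat_mulVec_one {n k : ℕ} (hk : 1 ≤ k) (hkn : k ≤ n) :
    Dmat n k *ᵥ (fun _ => (1 : ℝ)) = 0 := by
  ext i
  have hbinom : ∑ l ∈ Finset.range (k + 1), (k.choose l : ℝ) * (-1) ^ (k - l) = 0 := by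
    have h := add_pow (1 : ℝ) (-1) k
    rw [add_neg_cancel, zero_pow (by lia)] at h
    simpa [mul_comm] using h.symm
  simp only [mulVec, dotProduct, mul_one, Dmat, Pi.zero_apply]
  rw [Fin.sum_univ_eq_sum_range (fun j => if (i : ℕ) ≤ j ∧ j ≤ i + k then
    (k.choose (j - i) : ℝ) * (-1) ^ (k - (j - i)) else 0), ← Finset.sum_filter, ← hbinom]
  symm
  refine Finset.sum_bij' (fun l _ => l + i) (fun j _ => j - i) ?_ ?_ ?_ ?_ ?_ <;>
    simp only [Finset.mem_range, Finset.mem_filter, Nat.add_sub_cancel, implies_true] <;> lia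

/-- The Hessian `L = D(n,k)ᵀ H_N(n-k) D(n,k)` of the Bézier derivative norm is a
positive semidefinite (symmetric) matrix annihilating the all-ones vector, i.e. a
graph Laplacian of the Bézier control points. -/
theorem bezier_deriv_norm_hessian_is_laplacian (n k : ℕ) (hn : 1 ≤ n) (hk : 1 ≤ k)
    (hkn : k ≤ n) :
    ((Dmat n k)ᵀ * bezierNormHessian (n - k) * Dmat n k).PosSemidef ∧
      ((Dmat n k)ᵀ * bezierNormHessian (n - k) * Dmat n k).mulVec
          (fun _ => (1 : ℝ)) = 0 := by
  refine ⟨?_, ?_⟩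
  · simpa [conjTranspose_eq_transpose_of_trivial] using
      (bezierNormHessian_posSemidef (n - k)).conjTranspose_mul_mul_same (Dmat n k)
  · rw [← mulVec_mulVec, Dmat_mulVec_one hk hkn, mulVec_zero]
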